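/- Let H be a finite undirected graph in which every vertex has positive degree, let C ⊂ V_H be a set with conductance Φ(C) = φ > 0, and suppose T = (100·φ^{2/3})^{-1} is a positive integer. Then there exists a set C_g ⊆ C with vol(C_g) ≥ vol(C)/2 such that for any x ∈ C_g, with probability at least 7/9, a sample path (S₀, S₁, …, S_T) from the volume-biased evolving set process started from S₀ = {x} satisfies both: (i) Φ(S_t) < 60·φ^{1/3}·(ln vol(V_H))^{1/2} for some t ∈ [0, T]; and (ii) vol(S_t ∩ C) ≥ (1 − (1/10)·φ^{1/3})·vol(S_t) for all t ∈ [0, T]. -/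

import Mathlib

open Finset

namespace Paper

variable {V : Type*} [Fintype V] [DecidableEq V]

/-- The degree of a vertex `v` in the graph `G`. -/
noncomputable def deg (G : SimpleGraph V) (v : V) : ℕ := {u | G.Adj v u}.ncard

/-- The volume of a set of vertices: the sum of the degrees of its members. -/
noncomputable def vol (G : SimpleGraph V) (S : Finset V) : ℕ := ∑ v ∈ S, deg G v

/-- The number of ordered pairs `(u,v)` with `u ∈ S`, `v ∈ T` and `{u,v} ∈ E(G)`.
For disjoint `S`, `T` this is the number of edges between `S` and `T`, and
`cutEdges G S Sᶜ = |∂(S)|`. -/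
noncomputable def cutEdges (G : SimpleGraph V) (S T : Finset V) : ℕ :=
  {e : V × V | e.1 ∈ S ∧ e.2 ∈ T ∧ G.Adj e.1 e.2}.ncard

/-- The conductance `Φ(S) = |∂(S)| / min(vol(S), vol(V \ S))`. -/
noncomputable def conductance (G : SimpleGraph V) (S : Finset V) : ℝ :=
  (cutEdges G S Sᶜ : ℝ) / min (vol G S : ℝ) (vol G Sᶜ : ℝ)

/-- The bipartiteness ratio `β(L,R) = 1 - 2 e(L,R) / vol(L ∪ R)`. -/
noncomputable def bipartiteness (G : SimpleGraph V) (L R : Finset V) : ℝ :=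
  1 - 2 * (cutEdges G L R : ℝ) / (vol G (L ∪ R) : ℝ)

/-- The double cover of `G`: on vertex set `V ⊕ V` (with `Sum.inl v = v₁` and
`Sum.inr v = v₂`), for every edge `{u,v}` of `G` there are edges `{u₁,v₂}` and `{u₂,v₁}`. -/
def doubleCover (G : SimpleGraph V) : SimpleGraph (V ⊕ V) :=
  SimpleGraph.fromRel (fun x y => ∃ u v, x = Sum.inl u ∧ y = Sum.inr v ∧ G.Adj u v)

open scoped Classical in
/-- One step of the lazy random walk `W = (1/2)(I + D⁻¹A)`, acting on row vectors:
`p ↦ pW`, so `(lazyWalk G p) x = (1/2) p(x) + (1/2) ∑_{y ~ x} p(y)/deg(y)`. -/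
noncomputable def lazyWalk (G : SimpleGraph V) (p : V → ℝ) : V → ℝ :=
  fun x => (1/2) * p x + (1/2) * ∑ y, (if G.Adj y x then p y / (deg G y : ℝ) else 0)

/-- The simplify operator `σ` on vectors indexed by the double cover:
`(σ∘p)(u₁) = max(0, p(u₁) - p(u₂))` and `(σ∘p)(u₂) = max(0, p(u₂) - p(u₁))`. -/
noncomputable def simplify (p : V ⊕ V → ℝ) : V ⊕ V → ℝ :=
  Sum.elim (fun u => max 0 (p (Sum.inl u) - p (Sum.inr u)))
           (fun u => max 0 (p (Sum.inr u) - p (Sum.inl u)))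

/-- `q` is the personalised Pagerank vector `pr(α, s)`, i.e. it satisfies
`q = α s + (1-α) q W`. -/
def IsPagerank (G : SimpleGraph V) (α : ℝ) (s q : V → ℝ) : Prop :=
  ∀ x, q x = α * s x + (1 - α) * lazyWalk G q x

/-- `p` is an approximate Pagerank vector `apr(α, s, r)` with residual `r`, i.e.
`p + pr(α, r) = pr(α, s)`. -/
def IsApr (G : SimpleGraph V) (α : ℝ) (s r p : V → ℝ) : Prop :=
  ∃ qs qr, IsPagerank G α s qs ∧ IsPagerank G α r qr ∧ ∀ x, p x + qr x = qs x

/-- Given an ordering `ord` of the vertices, the sweep set `S_j` consists of the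
first `j` vertices in this ordering. -/
def sweepSet {W : Type*} [Fintype W] (ord : Fin (Fintype.card W) ≃ W) (j : ℕ) :
    Finset W :=
  Finset.univ.filter fun x => (ord.symm x : ℕ) < j

/-- The size of the support `supp(p) = {u : p(u) ≠ 0}` of a vector. -/
noncomputable def suppCard {W : Type*} (p : W → ℝ) : ℕ := {x | p x ≠ 0}.ncard

/-- The Lovász–Simonovits curve of a vector `p`:
`p[x] = max { ∑_u w(u) p(u) : w ∈ [0,1]^V, ∑_u w(u) deg(u) = x }`. -/
noncomputable def lsCurve (G : SimpleGraph V) (p : V → ℝ) (x : ℝ) : ℝ :=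
  sSup {y | ∃ w : V → ℝ, (∀ u, 0 ≤ w u ∧ w u ≤ 1) ∧
    (∑ u, w u * (deg G u : ℝ)) = x ∧ y = ∑ u, w u * p u}

/-! ### Directed graphs -/

/-- Out-degree of `u` in the digraph with edge relation `E`. -/
noncomputable def degOut (E : V → V → Prop) (u : V) : ℕ := {v | E u v}.ncard

/-- In-degree of `u` in the digraph with edge relation `E`. -/
noncomputable def degIn (E : V → V → Prop) (u : V) : ℕ := {v | E v u}.ncard

/-- Out-volume `vol_out(S) = ∑_{u ∈ S} deg_out(u)`. -/
noncomputable def volOut (E : V → V → Prop) (S : Finset V) : ℕ := ∑ u ∈ S, degOut E u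

/-- In-volume `vol_in(S) = ∑_{u ∈ S} deg_in(u)`. -/
noncomputable def volIn (E : V → V → Prop) (S : Finset V) : ℕ := ∑ u ∈ S, degIn E u

/-- The number of directed edges from `L` to `R`. -/
noncomputable def eDir (E : V → V → Prop) (L R : Finset V) : ℕ :=
  {e : V × V | e.1 ∈ L ∧ e.2 ∈ R ∧ E e.1 e.2}.ncard

/-- The total number of directed edges of the digraph. -/
noncomputable def numEdges (E : V → V → Prop) : ℕ := {e : V × V | E e.1 e.2}.ncard

/-- The flow ratio `F(L,R) = 1 - 2 e(L,R) / (vol_out(L) + vol_in(R))`. -/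
noncomputable def flowRatio (E : V → V → Prop) (L R : Finset V) : ℝ :=
  1 - 2 * (eDir E L R : ℝ) / ((volOut E L : ℝ) + (volIn E R : ℝ))

/-- The semi-double cover of a digraph: on vertex set `V ⊕ V` (with `Sum.inl v = v₁`,
`Sum.inr v = v₂`), for every directed edge `(u,v)` there is an undirected edge `{u₁, v₂}`. -/
def semiDoubleCover (E : V → V → Prop) : SimpleGraph (V ⊕ V) :=
  SimpleGraph.fromRel (fun x y => ∃ u v, x = Sum.inl u ∧ y = Sum.inr v ∧ E u v)

/-! ### The evolving set process -/

/-- `χ_v W χ_S^T`: the probability that one step of the lazy random walk started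
at `v` ends in `S`. -/
noncomputable def walkToSet (H : SimpleGraph V) (S : Finset V) (v : V) : ℝ :=
  (1/2) * (if v ∈ S then (1:ℝ) else 0)
    + (1/2) * (({y | H.Adj v y ∧ y ∈ S}.ncard : ℝ) / (deg H v : ℝ))

/-- The transition kernel `K(S, S')` of the evolving set process: the probability,
over a uniformly random threshold `t ∈ [0,1]`, that `{v : χ_v W χ_S^T ≥ t} = S'`. -/
noncomputable def espKernel (H : SimpleGraph V) (S S' : Finset V) : ℝ :=
  (MeasureTheory.volume {t : ℝ | t ∈ Set.Icc (0:ℝ) 1 ∧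
    {v | t ≤ walkToSet H S v} = (S' : Set V)}).toReal

/-- The transition kernel `K̂(S,S') = (vol(S')/vol(S)) K(S,S')` of the volume-biased
evolving set process. -/
noncomputable def vbKernel (H : SimpleGraph V) (S S' : Finset V) : ℝ :=
  ((vol H S' : ℝ) / (vol H S : ℝ)) * espKernel H S S'

open scoped Classical in
/-- The probability that a sample path `(S₀, …, S_T)` of the volume-biased evolving
set process started from `S₀ = {x}` satisfies the property `P`. -/
noncomputable def pathProb (H : SimpleGraph V) (T : ℕ) (x : V)
    (P : (Fin (T+1) → Finset V) → Prop) : ℝ :=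
  ∑ f ∈ Finset.univ.filter (fun f : Fin (T+1) → Finset V => f 0 = {x} ∧ P f),
    ∏ i : Fin T, vbKernel H (f i.castSucc) (f i.succ)


section AdjacencySums

/-- The real-valued adjacency indicator of `H`. -/
noncomputable def adjInd (H : SimpleGraph V) (u v : V) : ℝ :=
  open scoped Classical in if H.Adj u v then 1 else 0

omit [Fintype V] [DecidableEq V] in
lemma adjInd_nonneg (H : SimpleGraph V) (u v : V) : 0 ≤ adjInd H u v := by
  unfold adjInd; split_ifs <;> norm_num

omit [Fintype V] [DecidableEq V] in
lemma adjInd_comm (H : SimpleGraph V) (u v : V) : adjInd H u v = adjInd H v u := by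
  unfold adjInd
  congr 1
  exact propext (H.adj_comm u v)

omit [DecidableEq V] in
lemma deg_eq_sum (H : SimpleGraph V) (v : V) : (deg H v : ℝ) = ∑ u, adjInd H v u := by
  classical
  simp only [deg, adjInd]
  rw [Finset.sum_boole, Set.ncard_eq_toFinset_card']
  congr 2
  ext u; simp

omit [DecidableEq V] in
lemma ncard_adj_mem_eq_sum (H : SimpleGraph V) (S : Finset V) (v : V) :
    (({y | H.Adj v y ∧ y ∈ S}.ncard : ℕ) : ℝ) = ∑ u ∈ S, adjInd H v u := by
  classical
  simp only [adjInd]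
  rw [Finset.sum_boole, Set.ncard_eq_toFinset_card']
  congr 2
  ext u; simp [and_comm]

omit [DecidableEq V] in
lemma cutEdges_eq_sum (H : SimpleGraph V) (S T : Finset V) :
    (cutEdges H S T : ℝ) = ∑ u ∈ S, ∑ v ∈ T, adjInd H u v := by
  classical
  simp only [adjInd, cutEdges]
  rw [← Finset.sum_product', Finset.sum_boole, Set.ncard_eq_toFinset_card']
  congr 2
  ext u; simp [and_assoc]

omit [Fintype V] [DecidableEq V] in
lemma vol_cast (H : SimpleGraph V) (S : Finset V) : (vol H S : ℝ) = ∑ v ∈ S, (deg H v : ℝ) := by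
  simp [vol]

lemma vol_add_vol_compl (H : SimpleGraph V) (S : Finset V) :
    (vol H S : ℝ) + vol H Sᶜ = vol H Finset.univ := by
  simp only [vol_cast]
  exact Finset.sum_add_sum_compl S _

omit [Fintype V] [DecidableEq V] in
lemma vol_pos (H : SimpleGraph V) (hdeg : ∀ v, 0 < deg H v) {S : Finset V} (hS : S.Nonempty) :
    0 < vol H S :=
  Finset.sum_pos (fun v _ => hdeg v) hS

lemma deg_eq_sum_add_sum_compl (H : SimpleGraph V) (S : Finset V) (v : V) :
    (deg H v : ℝ) = ∑ u ∈ S, adjInd H v u + ∑ u ∈ Sᶜ, adjInd H v u := by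
  rw [deg_eq_sum, Finset.sum_add_sum_compl]

omit [DecidableEq V] in
lemma cutEdges_eq_sum_right (H : SimpleGraph V) (S T : Finset V) :
    (cutEdges H S T : ℝ) = ∑ v ∈ T, ∑ u ∈ S, adjInd H v u := by
  rw [cutEdges_eq_sum, Finset.sum_comm]
  simp only [adjInd_comm]

omit [DecidableEq V] in
lemma cutEdges_le_vol_left (H : SimpleGraph V) (S T : Finset V) :
    (cutEdges H S T : ℝ) ≤ vol H S := by
  rw [cutEdges_eq_sum, vol_cast]
  refine Finset.sum_le_sum fun v _ => ?_
  rw [deg_eq_sum]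
  exact Finset.sum_le_univ_sum_of_nonneg fun u => adjInd_nonneg H v u

omit [DecidableEq V] in
lemma cutEdges_le_vol_right (H : SimpleGraph V) (S T : Finset V) :
    (cutEdges H S T : ℝ) ≤ vol H T := by
  rw [cutEdges_eq_sum_right, vol_cast]
  refine Finset.sum_le_sum fun v _ => ?_
  rw [deg_eq_sum]
  exact Finset.sum_le_univ_sum_of_nonneg fun u => adjInd_nonneg H v u

end AdjacencySums

section WalkToSet

lemma walkToSet_eq (H : SimpleGraph V) (S : Finset V) (v : V) :
    walkToSet H S v = (1 / 2) * (if v ∈ S then (1 : ℝ) else 0)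
      + (1 / 2) * ((∑ u ∈ S, adjInd H v u) / deg H v) := by
  rw [walkToSet, ncard_adj_mem_eq_sum]

lemma deg_mul_walkToSet (H : SimpleGraph V) (hdeg : ∀ v, 0 < deg H v) (S : Finset V) (v : V) :
    (deg H v : ℝ) * walkToSet H S v =
      (1 / 2) * (if v ∈ S then (deg H v : ℝ) else 0) + (1 / 2) * ∑ u ∈ S, adjInd H v u := by
  have h : (deg H v : ℝ) ≠ 0 := by exact_mod_cast (hdeg v).ne'
  rw [walkToSet_eq]
  split_ifs
  · field_simp
  · field_simp
    ring

omit [DecidableEq V] in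
lemma sum_adjInd_div_deg_mem_Icc (H : SimpleGraph V) (hdeg : ∀ v, 0 < deg H v) (S : Finset V)
    (v : V) : (∑ u ∈ S, adjInd H v u) / deg H v ∈ Set.Icc (0 : ℝ) 1 := by
  have h : (0 : ℝ) < deg H v := by exact_mod_cast hdeg v
  refine ⟨div_nonneg (Finset.sum_nonneg fun u _ => adjInd_nonneg H v u) h.le, ?_⟩
  rw [div_le_one h, deg_eq_sum]
  exact Finset.sum_le_univ_sum_of_nonneg fun u => adjInd_nonneg H v u

lemma walkToSet_mem_Icc_of_mem (H : SimpleGraph V) (hdeg : ∀ v, 0 < deg H v) {S : Finset V}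
    {v : V} (hv : v ∈ S) : walkToSet H S v ∈ Set.Icc (1 / 2 : ℝ) 1 := by
  have h := sum_adjInd_div_deg_mem_Icc H hdeg S v
  rw [walkToSet_eq, if_pos hv]
  constructor <;> linarith [h.1, h.2]

lemma walkToSet_mem_Icc_of_notMem (H : SimpleGraph V) (hdeg : ∀ v, 0 < deg H v) {S : Finset V}
    {v : V} (hv : v ∉ S) : walkToSet H S v ∈ Set.Icc (0 : ℝ) (1 / 2) := by
  have h := sum_adjInd_div_deg_mem_Icc H hdeg S v
  rw [walkToSet_eq, if_neg hv]
  constructor <;> linarith [h.1, h.2]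

lemma sum_compl_deg_mul_walkToSet (H : SimpleGraph V) (hdeg : ∀ v, 0 < deg H v) (S : Finset V) :
    ∑ v ∈ Sᶜ, (deg H v : ℝ) * walkToSet H S v = cutEdges H S Sᶜ / 2 := by
  rw [cutEdges_eq_sum_right, Finset.sum_div]
  refine Finset.sum_congr rfl fun v hv => ?_
  rw [deg_mul_walkToSet H hdeg, if_neg (Finset.mem_compl.mp hv)]
  ring

lemma sum_deg_mul_walkToSet (H : SimpleGraph V) (hdeg : ∀ v, 0 < deg H v) (S : Finset V) :
    ∑ v ∈ S, (deg H v : ℝ) * walkToSet H S v = vol H S - cutEdges H S Sᶜ / 2 := by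
  rw [cutEdges_eq_sum, vol_cast, Finset.sum_div, ← Finset.sum_sub_distrib]
  refine Finset.sum_congr rfl fun v hv => ?_
  rw [deg_mul_walkToSet H hdeg, if_pos hv]
  linarith [deg_eq_sum_add_sum_compl H S v]

lemma sum_univ_deg_mul_walkToSet (H : SimpleGraph V) (hdeg : ∀ v, 0 < deg H v) (S : Finset V) :
    ∑ v, (deg H v : ℝ) * walkToSet H S v = vol H S := by
  rw [← Finset.sum_add_sum_compl S, sum_deg_mul_walkToSet H hdeg,
    sum_compl_deg_mul_walkToSet H hdeg]
  ring

end WalkToSet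

section Kernel

open MeasureTheory

/-- The set reached by one step of the evolving set process from `S` with threshold `t`. -/
noncomputable def levelSet (H : SimpleGraph V) (S : Finset V) (t : ℝ) : Finset V :=
  Finset.univ.filter fun v => t ≤ walkToSet H S v

/-- The part of the evolving set kernel coming from thresholds in `(a, b]`. -/
noncomputable def segKernel (H : SimpleGraph V) (a b : ℝ) (S S' : Finset V) : ℝ :=
  volume.real (Set.Ioc a b ∩ levelSet H S ⁻¹' {S'})

lemma segKernel_nonneg (H : SimpleGraph V) (a b : ℝ) (S S' : Finset V) :
    0 ≤ segKernel H a b S S' := measureReal_nonneg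

lemma measurableSet_levelSet_preimage (H : SimpleGraph V) (S S' : Finset V) :
    MeasurableSet (levelSet H S ⁻¹' {S'}) := by
  have : levelSet H S ⁻¹' {S'} = ⋂ v, {t : ℝ | t ≤ walkToSet H S v ↔ v ∈ S'} := by
    ext t
    simp [levelSet, Finset.ext_iff]
  rw [this]
  refine MeasurableSet.iInter fun v => ?_
  by_cases hv : v ∈ S'
  · simp only [hv, iff_true]
    exact measurableSet_Iic
  · simp only [hv, iff_false, not_le]
    exact measurableSet_Ioi

lemma sum_mem_segKernel (H : SimpleGraph V) (a b : ℝ) (S : Finset V)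
    (A : Finset (Finset V)) :
    ∑ S' ∈ A, segKernel H a b S S' =
      volume.real (Set.Ioc a b ∩ {t | levelSet H S t ∈ A}) := by
  unfold segKernel
  rw [← measureReal_biUnion_finset (h := fun S' _ =>
    ((measure_mono Set.inter_subset_left).trans_lt measure_Ioc_lt_top).ne)]
  · congr 1
    ext t
    simp
  · intro S₁ _ S₂ _ hne
    refine Set.disjoint_left.mpr fun t h₁ h₂ => hne ?_
    exact h₁.2.symm.trans h₂.2
  · exact fun S' _ => measurableSet_Ioc.inter (measurableSet_levelSet_preimage H S S')

lemma sum_segKernel (H : SimpleGraph V) {a b : ℝ} (hab : a ≤ b) (S : Finset V) :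
    ∑ S', segKernel H a b S S' = b - a := by
  rw [sum_mem_segKernel]
  simp [hab]

lemma sum_segKernel_mem (H : SimpleGraph V) (a b : ℝ) (S : Finset V) (v : V) :
    ∑ S', (if v ∈ S' then segKernel H a b S S' else 0) = max (min b (walkToSet H S v) - a) 0 := by
  rw [← Finset.sum_filter, sum_mem_segKernel, ← Real.volume_real_Ioc]
  congr 1
  ext t
  simp [levelSet, and_assoc]

lemma espKernel_eq (H : SimpleGraph V) (S S' : Finset V) :
    espKernel H S S' = segKernel H 0 (1 / 2) S S' + segKernel H (1 / 2) 1 S S' := by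
  have hset : {t : ℝ | t ∈ Set.Icc (0 : ℝ) 1 ∧ {v | t ≤ walkToSet H S v} = (S' : Set V)} =
      Set.Icc 0 1 ∩ levelSet H S ⁻¹' {S'} := by
    ext t
    simp [levelSet, Finset.ext_iff, Set.ext_iff]
  have hm := measurableSet_levelSet_preimage H S S'
  have hae : (Set.Icc (0 : ℝ) 1 ∩ levelSet H S ⁻¹' {S'} : Set ℝ) =ᵐ[volume]
      (Set.Ioc (0 : ℝ) 1 ∩ levelSet H S ⁻¹' {S'} : Set ℝ) :=
    Ioc_ae_eq_Icc.symm.inter (Filter.EventuallyEq.refl _ _)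
  unfold espKernel segKernel
  rw [hset, measure_congr hae, ← Set.Ioc_union_Ioc_eq_Ioc (b := (1 / 2 : ℝ)) (by norm_num)
    (by norm_num), Set.union_inter_distrib_right]
  refine measureReal_union ?_ (measurableSet_Ioc.inter hm)
    ((measure_mono Set.inter_subset_left).trans_lt measure_Ioc_lt_top).ne
    ((measure_mono Set.inter_subset_left).trans_lt measure_Ioc_lt_top).ne
  exact Set.disjoint_left.mpr fun t h₁ h₂ => absurd h₁.1.2 (not_le.mpr h₂.1.1)

omit [Fintype V] in
lemma espKernel_nonneg (H : SimpleGraph V) (S S' : Finset V) : 0 ≤ espKernel H S S' :=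
  ENNReal.toReal_nonneg

omit [Fintype V] in
lemma vbKernel_nonneg (H : SimpleGraph V) (S S' : Finset V) : 0 ≤ vbKernel H S S' :=
  mul_nonneg (by positivity) (espKernel_nonneg H S S')

lemma sum_segKernel_mul_sum (H : SimpleGraph V) (a b : ℝ) (S : Finset V) (g : V → ℝ) :
    ∑ S', segKernel H a b S S' * ∑ v ∈ S', g v =
      ∑ v, g v * max (min b (walkToSet H S v) - a) 0 := by
  have h : ∀ S' : Finset V, segKernel H a b S S' * ∑ v ∈ S', g v =
      ∑ v, g v * (if v ∈ S' then segKernel H a b S S' else 0) := by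
    intro S'
    simp only [mul_ite, mul_zero]
    rw [Finset.mul_sum, Finset.sum_ite_mem, Finset.univ_inter]
    exact Finset.sum_congr rfl fun v _ => mul_comm _ _
  simp only [h]
  rw [Finset.sum_comm]
  simp only [← Finset.mul_sum, sum_segKernel_mem]

lemma sum_segKernel_lower_mul_vol (H : SimpleGraph V) (hdeg : ∀ v, 0 < deg H v) (S : Finset V) :
    ∑ S', segKernel H 0 (1 / 2) S S' * (vol H S' : ℝ) =
      (vol H S + cutEdges H S Sᶜ) / 2 := by
  simp only [vol_cast H, sum_segKernel_mul_sum]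
  rw [← Finset.sum_add_sum_compl S, add_div, ← sum_compl_deg_mul_walkToSet H hdeg, Finset.sum_div]
  congr 1
  · refine Finset.sum_congr rfl fun v hv => ?_
    have h := walkToSet_mem_Icc_of_mem H hdeg hv
    rw [min_eq_left h.1, max_eq_left (by norm_num)]
    ring
  · refine Finset.sum_congr rfl fun v hv => ?_
    have h := walkToSet_mem_Icc_of_notMem H hdeg (Finset.mem_compl.mp hv)
    rw [min_eq_right h.2, sub_zero, max_eq_left h.1]

lemma sum_segKernel_upper_mul_vol (H : SimpleGraph V) (hdeg : ∀ v, 0 < deg H v) (S : Finset V) :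
    ∑ S', segKernel H (1 / 2) 1 S S' * (vol H S' : ℝ) =
      (vol H S - cutEdges H S Sᶜ) / 2 := by
  have hvol : ∑ v ∈ S, (deg H v : ℝ) * max (min 1 (walkToSet H S v) - 1 / 2) 0 =
      ∑ v ∈ S, (deg H v : ℝ) * walkToSet H S v - vol H S / 2 := by
    rw [vol_cast, Finset.sum_div, ← Finset.sum_sub_distrib]
    refine Finset.sum_congr rfl fun v hv => ?_
    have h := walkToSet_mem_Icc_of_mem H hdeg hv
    rw [min_eq_right h.2, max_eq_left (by linarith [h.1])]
    ring
  have hcompl : ∑ v ∈ Sᶜ, (deg H v : ℝ) * max (min 1 (walkToSet H S v) - 1 / 2) 0 = 0 := by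
    refine Finset.sum_eq_zero fun v hv => ?_
    have h := walkToSet_mem_Icc_of_notMem H hdeg (Finset.mem_compl.mp hv)
    rw [min_eq_right (by linarith [h.2]), max_eq_right (by linarith [h.2]), mul_zero]
  simp only [vol_cast H, sum_segKernel_mul_sum]
  rw [← Finset.sum_add_sum_compl S, hvol, hcompl, sum_deg_mul_walkToSet H hdeg, ← vol_cast]
  ring

lemma sum_espKernel_mul_sum (H : SimpleGraph V) (hdeg : ∀ v, 0 < deg H v) (S : Finset V)
    (g : V → ℝ) :
    ∑ S', espKernel H S S' * ∑ v ∈ S', g v = ∑ v, g v * walkToSet H S v := by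
  simp only [espKernel_eq, add_mul, Finset.sum_add_distrib, sum_segKernel_mul_sum]
  rw [← Finset.sum_add_distrib]
  refine Finset.sum_congr rfl fun v _ => ?_
  rw [← mul_add]
  congr 1
  by_cases hv : v ∈ S
  · have h := walkToSet_mem_Icc_of_mem H hdeg hv
    rw [min_eq_left h.1, min_eq_right h.2, max_eq_left (by norm_num),
      max_eq_left (by linarith [h.1])]
    ring
  · have h := walkToSet_mem_Icc_of_notMem H hdeg hv
    rw [min_eq_right h.2, min_eq_right (by linarith [h.2]), max_eq_left (by linarith [h.1]),
      max_eq_right (by linarith [h.2])]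
    ring

/-- Passing from the volume-biased kernel to the evolving set kernel. -/
lemma sum_vbKernel_mul_div_vol (H : SimpleGraph V) (hdeg : ∀ v, 0 < deg H v) (S : Finset V)
    (F : Finset V → ℝ) (hF : F ∅ = 0) :
    ∑ S', vbKernel H S S' * (F S' / vol H S') = (∑ S', espKernel H S S' * F S') / vol H S := by
  rw [Finset.sum_div]
  refine Finset.sum_congr rfl fun S' _ => ?_
  rcases S'.eq_empty_or_nonempty with rfl | hS'
  · simp [hF]
  · have h : (vol H S' : ℝ) ≠ 0 := by exact_mod_cast (vol_pos H hdeg hS').ne'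
    unfold vbKernel
    field_simp

omit [Fintype V] in
lemma vbKernel_empty (H : SimpleGraph V) (S : Finset V) : vbKernel H S ∅ = 0 := by
  simp [vbKernel, vol]

lemma sum_vbKernel (H : SimpleGraph V) (hdeg : ∀ v, 0 < deg H v) {S : Finset V}
    (hS : S.Nonempty) : ∑ S', vbKernel H S S' = 1 := by
  have h : (vol H S : ℝ) ≠ 0 := by exact_mod_cast (vol_pos H hdeg hS).ne'
  have := sum_espKernel_mul_sum H hdeg S (fun v => (deg H v : ℝ))
  rw [sum_univ_deg_mul_walkToSet H hdeg] at this
  simp only [← vol_cast] at this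
  calc ∑ S', vbKernel H S S' = (∑ S', espKernel H S S' * (vol H S' : ℝ)) / vol H S := by
        rw [Finset.sum_div]
        exact Finset.sum_congr rfl fun S' _ => by unfold vbKernel; ring
    _ = 1 := by rw [this, div_self h]

end Kernel

section GrowthGauge

lemma sqrt_le_half_div_add {y a : ℝ} (hy : 0 ≤ y) (ha : 0 < a) :
    √y ≤ (y / a + a) / 2 := by
  have h : (y / a + a) / 2 - √y = (√y - a) ^ 2 / (2 * a) := by
    field_simp
    nlinarith [Real.sq_sqrt hy]
  have : 0 ≤ (√y - a) ^ 2 / (2 * a) := by positivity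
  linarith

lemma sum_mul_sqrt_le {ι : Type*} [Fintype ι] {p y : ι → ℝ} (hp : ∀ i, 0 ≤ p i)
    (hy : ∀ i, 0 ≤ y i) {a : ℝ} (ha : 0 < a) :
    ∑ i, p i * √(y i) ≤ ((∑ i, p i * y i) / a + a * ∑ i, p i) / 2 := by
  calc ∑ i, p i * √(y i) ≤ ∑ i, p i * ((y i / a + a) / 2) :=
        Finset.sum_le_sum fun i _ =>
          mul_le_mul_of_nonneg_left (sqrt_le_half_div_add (hy i) ha) (hp i)
    _ = _ := by
        rw [Finset.sum_div, Finset.mul_sum, ← Finset.sum_add_distrib, Finset.sum_div]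
        exact Finset.sum_congr rfl fun i _ => by ring

lemma sum_add_mul_sqrt_le {ι : Type*} [Fintype ι] {p q y : ι → ℝ} (hp : ∀ i, 0 ≤ p i)
    (hq : ∀ i, 0 ≤ q i) (hy : ∀ i, 0 ≤ y i) {m δ : ℝ} (hm : 0 < m) (hδ : |δ| ≤ 1)
    (hp1 : ∑ i, p i = 1 / 2) (hq1 : ∑ i, q i = 1 / 2)
    (hpy : ∑ i, p i * y i = m * (1 + δ) / 2) (hqy : ∑ i, q i * y i = m * (1 - δ) / 2) :
    ∑ i, (p i + q i) * √(y i) ≤ √m * (1 - δ ^ 2 / 8) := by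
  obtain ⟨hδ1, hδ2⟩ := abs_le.mp hδ
  have hs : 0 < √m := Real.sqrt_pos.mpr hm
  have ha : 0 < 1 + δ / 2 := by linarith
  have hb : 0 < 1 - δ / 2 := by linarith
  have h1 := sum_mul_sqrt_le hp hy (mul_pos hs ha)
  have h2 := sum_mul_sqrt_le hq hy (mul_pos hs hb)
  rw [hp1, hpy] at h1
  rw [hq1, hqy] at h2
  simp only [add_mul, Finset.sum_add_distrib]
  refine (add_le_add h1 h2).trans ?_
  have hm' : m = √m * √m := (Real.mul_self_sqrt hm.le).symm
  have e1 : m * (1 + δ) / 2 / (√m * (1 + δ / 2)) = √m * ((1 + δ) / (1 + δ / 2)) / 2 := by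
    nth_rewrite 1 [hm']
    field_simp
  have e2 : m * (1 - δ) / 2 / (√m * (1 - δ / 2)) = √m * ((1 - δ) / (1 - δ / 2)) / 2 := by
    nth_rewrite 1 [hm']
    field_simp
  have f1 : (1 + δ) / (1 + δ / 2) = 1 + δ / 2 - δ ^ 2 / 4 / (1 + δ / 2) := by
    field_simp; ring
  have f2 : (1 - δ) / (1 - δ / 2) = 1 - δ / 2 - δ ^ 2 / 4 / (1 - δ / 2) := by
    field_simp; ring
  have g : δ ^ 2 / 2 ≤ δ ^ 2 / 4 / (1 + δ / 2) + δ ^ 2 / 4 / (1 - δ / 2) := by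
    rw [div_add_div _ _ ha.ne' hb.ne', le_div_iff₀ (mul_pos ha hb)]
    nlinarith [sq_nonneg (δ ^ 2)]
  rw [e1, e2, f1, f2]
  nlinarith [mul_le_mul_of_nonneg_left g hs.le]

/-- The smaller of the volumes of `S` and of its complement. -/
noncomputable def minVol (H : SimpleGraph V) (S : Finset V) : ℝ :=
  min (vol H S : ℝ) (vol H Sᶜ : ℝ)

lemma minVol_nonneg (H : SimpleGraph V) (S : Finset V) : 0 ≤ minVol H S :=
  le_min (Nat.cast_nonneg _) (Nat.cast_nonneg _)

lemma conductance_nonneg (H : SimpleGraph V) (S : Finset V) : 0 ≤ conductance H S :=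
  div_nonneg (Nat.cast_nonneg _) (minVol_nonneg H S)

lemma conductance_le_one (H : SimpleGraph V) (S : Finset V) : conductance H S ≤ 1 :=
  div_le_one_of_le₀ (le_min (cutEdges_le_vol_left H S Sᶜ) (cutEdges_le_vol_right H S Sᶜ))
    (minVol_nonneg H S)

lemma minVol_pos_of_conductance_pos (H : SimpleGraph V) {S : Finset V}
    (h : 0 < conductance H S) : 0 < minVol H S := by
  refine (minVol_nonneg H S).lt_of_ne fun h0 => h.ne' ?_
  rw [conductance, ← minVol, ← h0, div_zero]

lemma one_le_minVol (H : SimpleGraph V) {S : Finset V} (h : 0 < minVol H S) :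
    1 ≤ minVol H S := by
  obtain ⟨h1, h2⟩ := lt_min_iff.mp h
  exact le_min (by exact_mod_cast h1) (by exact_mod_cast h2)

lemma sum_espKernel_mul_sqrt_minVol_le (H : SimpleGraph V) (hdeg : ∀ v, 0 < deg H v)
    {S : Finset V} (hS : 0 < minVol H S) :
    ∑ S', espKernel H S S' * √(minVol H S') ≤
      √(minVol H S) * (1 - conductance H S ^ 2 / 8) := by
  have hΦ : |conductance H S| ≤ 1 := by
    rw [abs_of_nonneg (conductance_nonneg H S)]
    exact conductance_le_one H S
  have hcut : minVol H S * conductance H S = cutEdges H S Sᶜ := by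
    unfold conductance
    rw [← minVol, mul_div_cancel₀ _ hS.ne']
  have hlo := sum_segKernel H (show (0 : ℝ) ≤ 1 / 2 by norm_num) S
  have hup := sum_segKernel H (show (1 / 2 : ℝ) ≤ 1 by norm_num) S
  have hvlo := sum_segKernel_lower_mul_vol H hdeg S
  have hvup := sum_segKernel_upper_mul_vol H hdeg S
  simp only [espKernel_eq]
  rcases le_total (vol H S : ℝ) (vol H Sᶜ : ℝ) with hle | hle
  · have hmin : minVol H S = vol H S := min_eq_left hle
    refine (Finset.sum_le_sum fun S' _ => mul_le_mul_of_nonneg_left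
      (Real.sqrt_le_sqrt (min_le_left (vol H S' : ℝ) (vol H S'ᶜ : ℝ)))
      (add_nonneg (segKernel_nonneg ..) (segKernel_nonneg ..))).trans ?_
    refine sum_add_mul_sqrt_le (segKernel_nonneg H _ _ S) (segKernel_nonneg H _ _ S)
      (fun _ => Nat.cast_nonneg _) hS hΦ (by linarith) (by linarith) ?_ ?_
    · rw [hvlo]; linarith
    · rw [hvup]; linarith
  · have hmin : minVol H S = vol H Sᶜ := min_eq_right hle
    have hc : ∀ S' : Finset V, (vol H S'ᶜ : ℝ) = vol H Finset.univ - vol H S' := fun S' => by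
      linarith [vol_add_vol_compl H S']
    have hcS := hc S
    refine (Finset.sum_le_sum fun S' _ => mul_le_mul_of_nonneg_left
      (Real.sqrt_le_sqrt (min_le_right (vol H S' : ℝ) (vol H S'ᶜ : ℝ)))
      (add_nonneg (segKernel_nonneg ..) (segKernel_nonneg ..))).trans ?_
    rw [← neg_sq (conductance H S)]
    refine sum_add_mul_sqrt_le (segKernel_nonneg H _ _ S) (segKernel_nonneg H _ _ S)
      (fun _ => Nat.cast_nonneg _) hS (by rwa [abs_neg]) (by linarith) (by linarith) ?_ ?_
    · simp only [hc, mul_sub, Finset.sum_sub_distrib]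
      rw [hvlo, ← Finset.sum_mul, hlo]; linarith
    · simp only [hc, mul_sub, Finset.sum_sub_distrib]
      rw [hvup, ← Finset.sum_mul, hup]; linarith

lemma sum_vbKernel_mul_sqrt_minVol_div_vol_le (H : SimpleGraph V) (hdeg : ∀ v, 0 < deg H v)
    {S : Finset V} (hS : 0 < minVol H S) :
    ∑ S', vbKernel H S S' * (√(minVol H S') / vol H S') ≤
      √(minVol H S) / vol H S * (1 - conductance H S ^ 2 / 8) := by
  rw [sum_vbKernel_mul_div_vol H hdeg S (fun S' => √(minVol H S')) ?_,
    div_mul_eq_mul_div]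
  · exact div_le_div_of_nonneg_right (sum_espKernel_mul_sqrt_minVol_le H hdeg hS)
      (Nat.cast_nonneg _)
  · exact Real.sqrt_eq_zero_of_nonpos ((min_le_left _ _).trans (by simp [vol]))

end GrowthGauge

section Paths

open scoped Classical in
/-- The probability that all sets of a path of `n` steps from `S` satisfy `g`. -/
noncomputable def stayProb (H : SimpleGraph V) (g : Finset V → Prop) : ℕ → Finset V → ℝ
  | 0, S => if g S then 1 else 0
  | n + 1, S => if g S then ∑ S', vbKernel H S S' * stayProb H g n S' else 0

open scoped Classical in
lemma sum_paths_eq_stayProb (H : SimpleGraph V) (g : Finset V → Prop) (n : ℕ) (S : Finset V) :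
    ∑ f ∈ Finset.univ.filter (fun f : Fin (n + 1) → Finset V => f 0 = S ∧ ∀ t, g (f t)),
      ∏ i : Fin n, vbKernel H (f i.castSucc) (f i.succ) = stayProb H g n S := by
  induction n generalizing S with
  | zero =>
    rw [stayProb, Finset.sum_filter, ← (Equiv.funUnique (Fin 1) (Finset V)).symm.sum_comp]
    simp only [Finset.univ_eq_empty, Finset.prod_empty]
    rw [Finset.sum_eq_single S]
    · simp
    · intro b _ hb
      simp [hb]
    · simp
  | succ n ih =>
    rw [Finset.sum_filter, ← (Fin.consEquiv fun _ : Fin (n + 2) => Finset V).sum_comp,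
      Fintype.sum_prod_type, Finset.sum_eq_single S]
    · rw [stayProb]
      by_cases hS : g S
      · rw [if_pos hS]
        simp only [← ih, Finset.sum_filter, Finset.mul_sum]
        rw [Finset.sum_comm]
        refine Finset.sum_congr rfl fun f _ => ?_
        rw [Finset.sum_eq_single (f 0)]
        · simp only [Fin.consEquiv, Equiv.coe_fn_mk, Fin.cons_zero, true_and, Fin.forall_fin_succ,
            Fin.cons_succ, hS, Fin.prod_univ_succ, Fin.castSucc_zero, ← Fin.succ_castSucc]
          split_ifs <;> simp
        · intro S' _ hne
          rw [if_neg (fun h => hne h.1.symm), mul_zero]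
        · simp
      · rw [if_neg hS]
        refine Finset.sum_eq_zero fun f _ => if_neg fun h => hS ?_
        simpa [Fin.consEquiv] using h.2 0
    · intro S' _ hne
      refine Finset.sum_eq_zero fun f _ => if_neg fun h => hne ?_
      simpa [Fin.consEquiv] using h.1
    · simp

lemma stayProb_sub_le_pathProb (H : SimpleGraph V) (T : ℕ) (x : V) (a b : Finset V → Prop) :
    stayProb H b T {x} - stayProb H (fun S => ¬ a S) T {x} ≤
      pathProb H T x (fun f => (∃ t, a (f t)) ∧ ∀ t, b (f t)) := by
  classical
  rw [← sum_paths_eq_stayProb, ← sum_paths_eq_stayProb, pathProb, sub_le_iff_le_add]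
  simp only [Finset.sum_filter]
  rw [← Finset.sum_add_distrib]
  refine Finset.sum_le_sum fun f _ => ?_
  have hnn : 0 ≤ ∏ i : Fin T, vbKernel H (f i.castSucc) (f i.succ) :=
    Finset.prod_nonneg fun i _ => vbKernel_nonneg H _ _
  by_cases hb : f 0 = {x} ∧ ∀ t, b (f t)
  · by_cases ha : ∃ t, a (f t)
    · rw [if_pos hb, if_pos ⟨hb.1, ha, hb.2⟩]
      exact le_add_of_nonneg_right (by split_ifs <;> simp [hnn])
    · rw [if_pos hb, if_pos (c := f 0 = {x} ∧ ∀ t, ¬ a (f t)) ⟨hb.1, not_exists.mp ha⟩]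
      exact le_add_of_nonneg_left (by split_ifs <;> simp [hnn])
  · rw [if_neg hb]
    exact add_nonneg (by split_ifs <;> simp [hnn]) (by split_ifs <;> simp [hnn])

/-- A volume-biased path is unlikely to keep large conductance for a long time. -/
lemma stayProb_conductance_le (H : SimpleGraph V) (hdeg : ∀ v, 0 < deg H v) {θ : ℝ}
    (hθ : 0 < θ) (n : ℕ) (S : Finset V) :
    stayProb H (fun S => ¬ conductance H S < θ) n S ≤
      vol H Finset.univ * (√(minVol H S) / vol H S) * Real.exp (-(θ ^ 2 / 8)) ^ n := by
  induction n generalizing S with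
  | zero =>
    rw [stayProb]
    split_ifs with h
    · positivity
    · have hm := minVol_pos_of_conductance_pos H (hθ.trans_le (not_lt.mp h))
      have h1 := one_le_minVol H hm
      have hv : (0 : ℝ) < vol H S := hm.trans_le (min_le_left _ _)
      have hle : (vol H S : ℝ) ≤ vol H Finset.univ := by
        have := vol_add_vol_compl H S
        have : (0 : ℝ) ≤ vol H Sᶜ := Nat.cast_nonneg _
        linarith
      rw [pow_zero, mul_one, mul_div_assoc', one_le_div hv]
      have := Real.one_le_sqrt.mpr h1
      nlinarith
  | succ n ih =>
    rw [stayProb]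
    split_ifs with h
    · positivity
    · have hm := minVol_pos_of_conductance_pos H (hθ.trans_le (not_lt.mp h))
      have hρ : 1 - conductance H S ^ 2 / 8 ≤ Real.exp (-(θ ^ 2 / 8)) := by
        have := Real.add_one_le_exp (-(θ ^ 2 / 8))
        have : θ ^ 2 ≤ conductance H S ^ 2 := pow_le_pow_left₀ hθ.le (not_lt.mp h) 2
        linarith
      calc ∑ S', vbKernel H S S' * stayProb H (fun S => ¬ conductance H S < θ) n S'
          ≤ ∑ S', vbKernel H S S' * (vol H Finset.univ * (√(minVol H S') / vol H S') *
              Real.exp (-(θ ^ 2 / 8)) ^ n) :=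
            Finset.sum_le_sum fun S' _ => mul_le_mul_of_nonneg_left (ih S') (vbKernel_nonneg H _ _)
        _ = vol H Finset.univ * Real.exp (-(θ ^ 2 / 8)) ^ n *
              ∑ S', vbKernel H S S' * (√(minVol H S') / vol H S') := by
            rw [Finset.mul_sum]
            exact Finset.sum_congr rfl fun S' _ => by ring
        _ ≤ vol H Finset.univ * Real.exp (-(θ ^ 2 / 8)) ^ n *
              (√(minVol H S) / vol H S * Real.exp (-(θ ^ 2 / 8))) := by
            refine mul_le_mul_of_nonneg_left ?_ (by positivity)
            exact (sum_vbKernel_mul_sqrt_minVol_div_vol_le H hdeg hm).trans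
              (mul_le_mul_of_nonneg_left hρ (by positivity))
        _ = _ := by ring

end Paths

section Escape

/-- One step of the lazy walk acting on functions, `h ↦ W h`. -/
noncomputable def walkAverage (H : SimpleGraph V) (h : V → ℝ) (v : V) : ℝ :=
  (1 / 2) * h v + (1 / 2) * ((∑ u, adjInd H v u * h u) / deg H v)

/-- The probability that an `n`-step lazy walk from `v` visits the complement of `C`. -/
noncomputable def escapeProb (H : SimpleGraph V) (C : Finset V) : ℕ → V → ℝ
  | 0, v => if v ∈ C then 0 else 1
  | n + 1, v => if v ∈ C then walkAverage H (escapeProb H C n) v else 1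

omit [DecidableEq V] in
lemma walkAverage_nonneg (H : SimpleGraph V) {h : V → ℝ} (hh : ∀ v, 0 ≤ h v) (v : V) :
    0 ≤ walkAverage H h v := by
  have := Finset.sum_nonneg fun u (_ : u ∈ Finset.univ) =>
    mul_nonneg (adjInd_nonneg H v u) (hh u)
  have := hh v
  unfold walkAverage
  positivity

omit [DecidableEq V] in
lemma walkAverage_le_one (H : SimpleGraph V) {h : V → ℝ} (hh : ∀ v, h v ≤ 1) (v : V) :
    walkAverage H h v ≤ 1 := by
  have : (∑ u, adjInd H v u * h u) / deg H v ≤ 1 := by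
    refine div_le_one_of_le₀ ?_ (Nat.cast_nonneg _)
    rw [deg_eq_sum]
    exact Finset.sum_le_sum fun u _ => mul_le_of_le_one_right (adjInd_nonneg H v u) (hh u)
  unfold walkAverage
  linarith [hh v]

lemma sum_deg_mul_walkAverage (H : SimpleGraph V) (hdeg : ∀ v, 0 < deg H v) (S : Finset V)
    (h : V → ℝ) :
    ∑ v ∈ S, (deg H v : ℝ) * walkAverage H h v = ∑ u, deg H u * h u * walkToSet H S u := by
  have hl : ∀ v, (deg H v : ℝ) * walkAverage H h v =
      (1 / 2) * (deg H v * h v) + (1 / 2) * ∑ u, adjInd H v u * h u := by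
    intro v
    have hv : (deg H v : ℝ) ≠ 0 := by exact_mod_cast (hdeg v).ne'
    unfold walkAverage
    field_simp
  have hr : ∀ u, deg H u * h u * walkToSet H S u =
      (1 / 2) * (if u ∈ S then deg H u * h u else 0) +
        (1 / 2) * ∑ v ∈ S, adjInd H v u * h u := by
    intro u
    rw [mul_right_comm, deg_mul_walkToSet H hdeg, add_mul, mul_assoc, mul_assoc, ite_mul, zero_mul,
      Finset.sum_mul]
    simp only [adjInd_comm H u]
  simp only [hl, hr, Finset.sum_add_distrib, ← Finset.mul_sum]
  rw [Finset.sum_comm]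
  simp

lemma escapeProb_nonneg (H : SimpleGraph V) (C : Finset V) (n : ℕ) (v : V) :
    0 ≤ escapeProb H C n v := by
  induction n generalizing v with
  | zero => rw [escapeProb]; split_ifs <;> norm_num
  | succ n ih =>
    rw [escapeProb]
    split_ifs
    exacts [walkAverage_nonneg H ih v, zero_le_one]

lemma escapeProb_le_one (H : SimpleGraph V) (C : Finset V) (n : ℕ) (v : V) :
    escapeProb H C n v ≤ 1 := by
  induction n generalizing v with
  | zero => rw [escapeProb]; split_ifs <;> norm_num
  | succ n ih =>
    rw [escapeProb]
    split_ifs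
    exacts [walkAverage_le_one H ih v, le_rfl]

lemma escapeProb_of_notMem (H : SimpleGraph V) {C : Finset V} (n : ℕ) {v : V} (hv : v ∉ C) :
    escapeProb H C n v = 1 := by
  cases n <;> simp [escapeProb, hv]

lemma walkAverage_escapeProb_le (H : SimpleGraph V) (C : Finset V) (n : ℕ) (v : V) :
    walkAverage H (escapeProb H C n) v ≤ escapeProb H C (n + 1) v := by
  rw [escapeProb]
  split_ifs
  exacts [le_rfl, walkAverage_le_one H (escapeProb_le_one H C n) v]

lemma sum_deg_mul_escapeProb_le (H : SimpleGraph V) (hdeg : ∀ v, 0 < deg H v) (C : Finset V)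
    (n : ℕ) :
    ∑ v ∈ C, (deg H v : ℝ) * escapeProb H C n v ≤ n * (cutEdges H C Cᶜ / 2) := by
  induction n with
  | zero =>
    rw [Finset.sum_eq_zero fun v hv => by simp [escapeProb, hv]]
    simp
  | succ n ih =>
    have h1 : ∑ v ∈ C, (deg H v : ℝ) * escapeProb H C (n + 1) v =
        ∑ v ∈ C, (deg H v : ℝ) * walkAverage H (escapeProb H C n) v :=
      Finset.sum_congr rfl fun v hv => by rw [escapeProb, if_pos hv]
    rw [h1, sum_deg_mul_walkAverage H hdeg, ← Finset.sum_add_sum_compl C, Nat.cast_succ, add_mul,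
      one_mul]
    refine add_le_add ((Finset.sum_le_sum fun v hv => ?_).trans ih) (le_of_eq ?_)
    · exact mul_le_of_le_one_right
        (mul_nonneg (Nat.cast_nonneg _) (escapeProb_nonneg H C n v))
        (walkToSet_mem_Icc_of_mem H hdeg hv).2
    · rw [← sum_compl_deg_mul_walkToSet H hdeg]
      refine Finset.sum_congr rfl fun v hv => ?_
      rw [escapeProb_of_notMem H n (Finset.mem_compl.mp hv), mul_one]

/-- The probability that an `n`-step lazy walk started from the degree distribution on `S`
visits the complement of `C`. -/
noncomputable def meanEscape (H : SimpleGraph V) (C : Finset V) (n : ℕ) (S : Finset V) : ℝ :=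
  (∑ v ∈ S, (deg H v : ℝ) * escapeProb H C n v) / vol H S

lemma sum_vbKernel_mul_meanEscape_le (H : SimpleGraph V) (hdeg : ∀ v, 0 < deg H v)
    (C : Finset V) (n : ℕ) (S : Finset V) :
    ∑ S', vbKernel H S S' * meanEscape H C n S' ≤ meanEscape H C (n + 1) S := by
  unfold meanEscape
  rw [sum_vbKernel_mul_div_vol H hdeg S (fun S' => ∑ v ∈ S', (deg H v : ℝ) * escapeProb H C n v)
    (by simp), sum_espKernel_mul_sum H hdeg, ← sum_deg_mul_walkAverage H hdeg]
  exact div_le_div_of_nonneg_right (Finset.sum_le_sum fun v _ =>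
    mul_le_mul_of_nonneg_left (walkAverage_escapeProb_le H C n v) (Nat.cast_nonneg _))
    (Nat.cast_nonneg _)

lemma meanEscape_nonneg (H : SimpleGraph V) (C : Finset V) (n : ℕ) (S : Finset V) :
    0 ≤ meanEscape H C n S :=
  div_nonneg (Finset.sum_nonneg fun v _ =>
    mul_nonneg (Nat.cast_nonneg _) (escapeProb_nonneg H C n v)) (Nat.cast_nonneg _)

lemma lt_meanEscape (H : SimpleGraph V) (hdeg : ∀ v, 0 < deg H v) (C : Finset V) (n : ℕ)
    {S : Finset V} (hS : S.Nonempty) {ε : ℝ}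
    (h : ¬ (1 - ε) * (vol H S : ℝ) ≤ (vol H (S ∩ C) : ℝ)) : ε < meanEscape H C n S := by
  have hv : (0 : ℝ) < vol H S := by exact_mod_cast vol_pos H hdeg hS
  have hsub : (vol H S : ℝ) - vol H (S ∩ C) ≤
      ∑ v ∈ S, (deg H v : ℝ) * escapeProb H C n v := by
    rw [vol_cast, vol_cast, ← Finset.sum_inter_add_sum_sdiff S C, add_sub_cancel_left,
      ← Finset.sum_inter_add_sum_sdiff S C]
    refine le_add_of_nonneg_of_le (Finset.sum_nonneg fun v _ =>
      mul_nonneg (Nat.cast_nonneg _) (escapeProb_nonneg H C n v)) (Finset.sum_le_sum fun v hv => ?_)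
    rw [escapeProb_of_notMem H n (Finset.mem_sdiff.mp hv).2, mul_one]
  rw [meanEscape, lt_div_iff₀ hv]
  linarith

/-- A volume-biased path stays almost inside `C` unless the lazy walk is likely to escape. -/
lemma one_sub_meanEscape_div_le_stayProb (H : SimpleGraph V) (hdeg : ∀ v, 0 < deg H v)
    (C : Finset V) {ε : ℝ} (hε : 0 < ε) (n : ℕ) {S : Finset V} (hS : S.Nonempty) :
    1 - meanEscape H C n S / ε ≤
      stayProb H (fun S => (1 - ε) * (vol H S : ℝ) ≤ (vol H (S ∩ C) : ℝ)) n S := by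
  induction n generalizing S with
  | zero =>
    rw [stayProb]
    split_ifs with h
    · linarith [div_nonneg (meanEscape_nonneg H C 0 S) hε.le]
    · linarith [(one_lt_div hε).mpr (lt_meanEscape H hdeg C 0 hS h)]
  | succ n ih =>
    rw [stayProb]
    split_ifs with h
    · calc 1 - meanEscape H C (n + 1) S / ε
          ≤ 1 - (∑ S', vbKernel H S S' * meanEscape H C n S') / ε := by
            gcongr
            exact sum_vbKernel_mul_meanEscape_le H hdeg C n S
        _ = ∑ S', vbKernel H S S' * (1 - meanEscape H C n S' / ε) := by
            simp only [mul_sub, mul_one, Finset.sum_sub_distrib, sum_vbKernel H hdeg hS,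
              mul_div_assoc', Finset.sum_div]
        _ ≤ _ := by
            refine Finset.sum_le_sum fun S' _ => ?_
            rcases S'.eq_empty_or_nonempty with rfl | hS'
            · simp [vbKernel_empty]
            · exact mul_le_mul_of_nonneg_left (ih hS') (vbKernel_nonneg H _ _)
    · linarith [(one_lt_div hε).mpr (lt_meanEscape H hdeg C (n + 1) hS h)]

lemma exists_large_subset_escapeProb_le (H : SimpleGraph V) (hdeg : ∀ v, 0 < deg H v)
    (C : Finset V) (hC : 0 < conductance H C) {n : ℕ} (hn : 0 < n) :
    ∃ Cg ⊆ C, (vol H C : ℝ) / 2 ≤ vol H Cg ∧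
      ∀ x ∈ Cg, escapeProb H C n x ≤ n * conductance H C := by
  refine ⟨C.filter fun v => escapeProb H C n v ≤ n * conductance H C, Finset.filter_subset _ _, ?_,
    fun x hx => (Finset.mem_filter.mp hx).2⟩
  set a : ℝ := n * conductance H C with ha
  have hapos : 0 < a := mul_pos (by exact_mod_cast hn) hC
  have hcut : (cutEdges H C Cᶜ : ℝ) ≤ conductance H C * vol H C := by
    have hm := minVol_pos_of_conductance_pos H hC
    calc (cutEdges H C Cᶜ : ℝ) = conductance H C * minVol H C := by
          rw [conductance, ← minVol, div_mul_cancel₀ _ hm.ne']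
      _ ≤ _ := mul_le_mul_of_nonneg_left (min_le_left _ _) hC.le
  have hsum : ∑ v ∈ C, (deg H v : ℝ) * escapeProb H C n v ≤ a * (vol H C / 2) := by
    refine (sum_deg_mul_escapeProb_le H hdeg C n).trans ?_
    rw [ha, mul_assoc]
    refine mul_le_mul_of_nonneg_left ?_ (Nat.cast_nonneg _)
    linarith
  have hsplit := Finset.sum_filter_add_sum_filter_not C (fun v => escapeProb H C n v ≤ a)
    (fun v => (deg H v : ℝ))
  have hbad : a * ∑ v ∈ C with ¬ escapeProb H C n v ≤ a, (deg H v : ℝ) ≤ a * (vol H C / 2) := by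
    refine le_trans ?_ hsum
    rw [Finset.mul_sum]
    refine (Finset.sum_le_sum fun v hv => ?_).trans (Finset.sum_le_sum_of_subset_of_nonneg
      (Finset.filter_subset _ _) fun v _ _ =>
        mul_nonneg (Nat.cast_nonneg _) (escapeProb_nonneg H C n v))
    rw [mul_comm]
    exact mul_le_mul_of_nonneg_left (not_le.mp (Finset.mem_filter.mp hv).2).le (Nat.cast_nonneg _)
  have := le_of_mul_le_mul_left hbad hapos
  rw [← vol_cast, ← vol_cast, ← vol_cast] at hsplit
  rw [← vol_cast] at this
  linarith

end Escape

/-- Let `H` have positive degrees everywhere, `C ⊂ V_H` with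
conductance `Φ(C) = φ > 0`, and suppose `T = (100 φ^{2/3})⁻¹` is a positive integer.
Then there is `C_g ⊆ C` with `vol(C_g) ≥ vol(C)/2` such that for any `x ∈ C_g`,
with probability at least `7/9`, a sample path `(S₀, …, S_T)` of the volume-biased
evolving set process started from `S₀ = {x}` satisfies both:
(i) `Φ(S_t) < 60 φ^{1/3} (ln vol(V_H))^{1/2}` for some `t ∈ [0,T]`; and
(ii) `vol(S_t ∩ C) ≥ (1 - (1/10) φ^{1/3}) vol(S_t)` for all `t ∈ [0,T]`. -/
theorem statement15 (H : SimpleGraph V) (hdeg : ∀ v, 0 < deg H v)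
    (C : Finset V) (hC : C ⊂ Finset.univ)
    (φ : ℝ) (hφ : conductance H C = φ) (hφ0 : 0 < φ)
    (T : ℕ) (hT0 : 0 < T) (hT : (T : ℝ) = 1 / (100 * φ ^ ((2:ℝ)/3))) :
    ∃ Cg ⊆ C, (vol H C : ℝ) / 2 ≤ (vol H Cg : ℝ) ∧
      ∀ x ∈ Cg,
        7 / 9 ≤ pathProb H T x (fun f =>
          (∃ t : Fin (T+1), conductance H (f t)
              < 60 * φ ^ ((1:ℝ)/3) * Real.sqrt (Real.log (vol H Finset.univ))) ∧
          (∀ t : Fin (T+1),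
            (1 - (1/10) * φ ^ ((1:ℝ)/3)) * (vol H (f t) : ℝ)
              ≤ (vol H (f t ∩ C) : ℝ))) := by
  have hm : 0 < minVol H C := minVol_pos_of_conductance_pos H (hφ ▸ hφ0)
  have hvol : (2 : ℝ) ≤ vol H Finset.univ := by
    have h1 := one_le_minVol H hm
    linarith [h1.trans (min_le_left _ _), h1.trans (min_le_right _ _), vol_add_vol_compl H C]
  have hlog : 0 < Real.log (vol H Finset.univ) := Real.log_pos (by linarith)
  set r : ℝ := φ ^ ((1 : ℝ) / 3) with hr
  have hr0 : 0 < r := Real.rpow_pos_of_pos hφ0 _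
  have hr2 : φ ^ ((2 : ℝ) / 3) = r ^ 2 := by
    rw [hr, ← Real.rpow_natCast, ← Real.rpow_mul hφ0.le]; norm_num
  have hr3 : φ = r ^ 3 := by
    rw [hr, ← Real.rpow_natCast, ← Real.rpow_mul hφ0.le]; norm_num
  have hTr : (T : ℝ) * r ^ 2 = 1 / 100 := by
    rw [hT, hr2]; field_simp
  obtain ⟨Cg, hCg, hCgvol, hesc⟩ :=
    exists_large_subset_escapeProb_le H hdeg C (hφ ▸ hφ0) hT0
  refine ⟨Cg, hCg, hCgvol, fun x hx => ?_⟩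
  have hdx : (1 : ℝ) ≤ deg H x := by exact_mod_cast hdeg x
  have hvx : (vol H {x} : ℝ) = deg H x := by simp [vol]
  set θ : ℝ := 60 * r * √(Real.log (vol H Finset.univ)) with hθ
  have hθ0 : 0 < θ := by positivity
  refine le_trans ?_ (stayProb_sub_le_pathProb H T x (fun S => conductance H S < θ)
    (fun S => (1 - (1/10) * r) * (vol H S : ℝ) ≤ (vol H (S ∩ C) : ℝ)))
  have hstay := one_sub_meanEscape_div_le_stayProb H hdeg C
    (show 0 < (1 / 10) * r by positivity) T (Finset.singleton_nonempty x)
  have hmean : meanEscape H C T {x} / ((1 / 10) * r) ≤ 1 / 10 := by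
    have : meanEscape H C T {x} = escapeProb H C T x := by
      rw [meanEscape, hvx, Finset.sum_singleton, mul_div_cancel_left₀ _ (by linarith)]
    rw [this, div_le_iff₀ (by positivity)]
    refine (hesc x hx).trans (le_of_eq ?_)
    rw [hφ, hr3, pow_succ, ← mul_assoc, hTr]
    ring
  have hcond := stayProb_conductance_le H hdeg hθ0 T {x}
  have hZ : √(minVol H {x}) / vol H {x} ≤ 1 := by
    rw [hvx, div_le_one (by linarith), Real.sqrt_le_left (by linarith)]
    refine (min_le_left _ _).trans ?_
    rw [hvx]
    nlinarith
  set u : ℝ := Real.exp (-(Real.log (vol H Finset.univ) / 2)) with hu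
  have hu0 : 0 < u := Real.exp_pos _
  have hu2 : vol H Finset.univ * u ^ 2 = 1 := by
    rw [hu, ← Real.exp_nat_mul]
    nth_rewrite 1 [← Real.exp_log (show (0 : ℝ) < vol H Finset.univ by linarith)]
    rw [← Real.exp_add, Real.exp_eq_one_iff]
    push_cast
    ring
  have hexp : Real.exp (-(θ ^ 2 / 8)) ^ T = u ^ 9 := by
    rw [hu, ← Real.exp_nat_mul, ← Real.exp_nat_mul, hθ, mul_pow, Real.sq_sqrt hlog.le]
    congr 1
    push_cast
    linear_combination (-450 * Real.log (vol H Finset.univ)) * hTr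
  have hsmall : vol H Finset.univ * (√(minVol H {x}) / vol H {x}) *
      Real.exp (-(θ ^ 2 / 8)) ^ T ≤ 3 / 32 := by
    have hu_half : u ^ 2 ≤ 1 / 2 := by nlinarith [sq_nonneg u]
    have hu_le : u ≤ 3 / 4 := by nlinarith
    have hu6 : (u ^ 2) ^ 3 ≤ (1 / 2) ^ 3 := pow_le_pow_left₀ (sq_nonneg u) hu_half 3
    calc _ ≤ vol H Finset.univ * 1 * u ^ 9 := by rw [hexp]; gcongr
      _ = (u ^ 2) ^ 3 * u := by linear_combination u ^ 7 * hu2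
      _ ≤ (1 / 2) ^ 3 * (3 / 4) := by gcongr
      _ = 3 / 32 := by norm_num
  linarith

end Paper
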